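/- arXiv:2503.06429 — 3 statements merged into one kernel-verified Lean document; each statement's English description precedes it below -/
import Mathlib

section
/- Let M be a finite group and U ≤ M. If χ is an irreducible complex character of M such that the inner product [χ_U, χ_U] = |M : U|, then χ vanishes on M ∖ U. -/
open scoped BigOperators Classical

def IsChar (G : Type) [Group G] (f : G → ℂ) : Prop :=
  ∃ V : FDRep ℂ G, f = V.character

def IsIrrChar (G : Type) [Group G] (f : G → ℂ) : Prop :=
  ∃ V : FDRep ℂ G, CategoryTheory.Simple V ∧ f = V.character

noncomputable def charInner (H : Type*) [Group H] [Fintype H] (f g : H → ℂ) : ℂ :=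
  (Fintype.card H : ℂ)⁻¹ * ∑ h : H, f h * starRingEnd ℂ (g h)

noncomputable def indChar {G : Type*} [Group G] [Fintype G] (U : Subgroup G) (f : U → ℂ) : G → ℂ :=
  fun g => (Nat.card U : ℂ)⁻¹ * ∑ x : G, if h : x * g * x⁻¹ ∈ U then f ⟨x * g * x⁻¹, h⟩ else 0

def conjChar {G : Type*} [Group G] (N : Subgroup G) [hN : N.Normal] (g : G) (θ : N → ℂ) : N → ℂ :=
  fun n => θ ⟨g * n * g⁻¹, hN.conj_mem n n.2 g⟩

/-- The trace of a complex matrix representation of a finite group at `g⁻¹` is the conjugate of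
its trace at `g`. -/
theorem Matrix.trace_map_inv_eq_star {G n : Type*} [Group G] [Fintype G] [Fintype n]
    [DecidableEq n] (R : G →* Matrix n n ℂ) (g : G) : (R g⁻¹).trace = star (R g).trace := by
  open scoped ComplexOrder in
  set P : Matrix n n ℂ := ∑ x : G, (R x).conjTranspose * R x with hP
  have hpos : P.PosDef := by
    rw [hP, ← Finset.add_sum_erase _ _ (Finset.mem_univ (1 : G)), map_one]
    refine Matrix.PosDef.add_posSemidef (by simpa using Matrix.PosDef.one) ?_
    exact Matrix.posSemidef_sum _ fun x _ => Matrix.posSemidef_conjTranspose_mul_self (R x)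
  have hdet : IsUnit P.det := (Matrix.isUnit_iff_isUnit_det P).mp hpos.isUnit
  have hinv : (R g).conjTranspose * P * R g = P := by
    rw [hP, Finset.mul_sum, Finset.sum_mul]
    refine Fintype.sum_equiv (Equiv.mulRight g) _ _ fun x => ?_
    simp [Matrix.conjTranspose_mul, Matrix.mul_assoc]
  have hconj : P * R g⁻¹ = (R g).conjTranspose * P := by
    conv_lhs => rw [← hinv]
    rw [Matrix.mul_assoc, ← map_mul, mul_inv_cancel, map_one, Matrix.mul_one]
  calc (R g⁻¹).trace = (P⁻¹ * (P * R g⁻¹)).trace := by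
        rw [Matrix.nonsing_inv_mul_cancel_left _ _ hdet]
    _ = star (R g).trace := by
        rw [hconj, Matrix.trace_mul_comm, Matrix.mul_nonsing_inv_cancel_right _ _ hdet,
          Matrix.trace_conjTranspose]

theorem FDRep.char_inv_eq_star {G : Type*} [Group G] [Fintype G] (V : FDRep ℂ G) (g : G) :
    V.character g⁻¹ = star (V.character g) := by
  let b := Module.finBasis ℂ V
  let R : G →* Matrix _ _ ℂ :=
    (LinearMap.toMatrixAlgEquiv b).toMulEquiv.toMonoidHom.comp V.ρ
  have hR (x : G) : V.character x = (R x).trace := LinearMap.trace_eq_matrix_trace ℂ b (V.ρ x)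
  rw [hR, hR, Matrix.trace_map_inv_eq_star]

theorem IsIrrChar.sum_normSq {M : Type} [Group M] [Fintype M] {χ : M → ℂ}
    (hχ : IsIrrChar M χ) : ∑ m : M, Complex.normSq (χ m) = Fintype.card M := by
  obtain ⟨V, hV, rfl⟩ := hχ
  have horth := FDRep.char_orthonormal V V
  rw [if_pos ⟨CategoryTheory.Iso.refl V⟩, inv_mul_eq_one₀ (by simp)] at horth
  have hc : ((∑ m : M, Complex.normSq (V.character m) : ℝ) : ℂ) = Fintype.card M := by
    rw [Complex.ofReal_sum]
    simp_rw [← Complex.mul_conj]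
    simpa [FDRep.char_inv_eq_star] using horth.symm
  exact_mod_cast hc

/-- If `χ` is an irreducible character of a finite group `M` and the inner product of its
restriction to a subgroup `U` with itself equals the index `|M : U|`, then `χ` vanishes
on `M ∖ U`. -/
theorem irrChar_vanishes_off_subgroup_of_inner_eq_index (M : Type) [Group M] [Fintype M]
    (U : Subgroup M) (χ : M → ℂ) (hχ : IsIrrChar M χ)
    (h : charInner U (fun u : U => χ u) (fun u : U => χ u) = (U.index : ℂ)) :
    ∀ m : M, m ∉ U → χ m = 0 := by
  have hU : ∑ u : U, Complex.normSq (χ u) = Fintype.card M := by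
    have hc : ((∑ u : U, Complex.normSq (χ u) : ℝ) : ℂ) = Fintype.card M := by
      rw [charInner, inv_mul_eq_iff_eq_mul₀ (by simp)] at h
      rw [Complex.ofReal_sum]
      simp_rw [← Complex.mul_conj]
      rw [h, ← Nat.card_eq_fintype_card, ← Nat.card_eq_fintype_card, ← U.card_mul_index]
      push_cast
      rfl
    exact_mod_cast hc
  have hsplit := Fintype.sum_subtype_add_sum_subtype (· ∈ U) fun m => Complex.normSq (χ m)
  have hzero : ∑ m : {m // m ∉ U}, Complex.normSq (χ m) = 0 := by
    have := hχ.sum_normSq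
    change ∑ u : {m // m ∈ U}, Complex.normSq (χ u) = _ at hU
    linarith
  intro m hm
  rw [Fintype.sum_eq_zero_iff_of_nonneg fun _ => Complex.normSq_nonneg _] at hzero
  exact Complex.normSq_eq_zero.mp (congrFun hzero ⟨m, hm⟩)
end

section
/- Let G be a finite group, N ⊴ G, θ ∈ Irr(N), and let T = G_θ be the inertia group (stabilizer) of θ in G. Then induction ψ ↦ ψ^G is a bijection between the irreducible characters of T lying over θ and the irreducible characters of G lying over θ. -/
open scoped BigOperators Classical

section
variable {G : Type*} [Group G] (N : Subgroup G) [hN : N.Normal]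

private lemma conjChar_comp (g h : G) (θ : N → ℂ) :
    conjChar N (g * h) θ = conjChar N h (conjChar N g θ) := by
  funext n
  simp only [conjChar]
  congr 1
  ext
  push_cast
  group

private lemma conjChar_one (θ : N → ℂ) : conjChar N 1 θ = θ := by
  funext n
  simp only [conjChar]
  congr 1
  ext
  push_cast
  group

/-- The inertia group `G_θ = {g ∈ G : θ^g = θ}` of a character `θ` of a normal
subgroup `N` of `G`. -/
def inertia (θ : N → ℂ) : Subgroup G where
  carrier := {g | conjChar N g θ = θ}
  one_mem' := conjChar_one N θ
  mul_mem' := by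
    intro a b ha hb
    show conjChar N (a * b) θ = θ
    rw [conjChar_comp, ha, hb]
  inv_mem' := by
    intro a ha
    show conjChar N a⁻¹ θ = θ
    have h1 : conjChar N (a * a⁻¹) θ = conjChar N a⁻¹ (conjChar N a θ) := conjChar_comp ..
    rw [ha, mul_inv_cancel, conjChar_one] at h1
    exact h1.symm

end

section

open Module CategoryTheory

/-- The character of a finite-order endomorphism at the inverse is the complex conjugate. -/
theorem trace_eq_conj_trace_of_pow_eq_one {V : Type*} [AddCommGroup V] [Module ℂ V]
    [FiniteDimensional ℂ V] {A B : Module.End ℂ V} {n : ℕ} (hn : n ≠ 0) (hA : A ^ n = 1)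
    (hBA : B * A = 1) : LinearMap.trace ℂ V B = starRingEnd ℂ (LinearMap.trace ℂ V A) := by
  have hs : A.IsSemisimple := by
    refine Module.End.isSemisimple_of_squarefree_aeval_eq_zero (p := Polynomial.X ^ n - 1) ?_ ?_
    · exact ((Polynomial.X_pow_sub_one_separable_iff).2 (by exact_mod_cast hn)).squarefree
    · simp [hA]
  have htop := hs.iSup_eigenspace_eq_top
  have hint : DirectSum.IsInternal A.eigenspace :=
    DirectSum.isInternal_submodule_of_iSupIndep_of_iSup_eq_top A.eigenspaces_iSupIndep htop
  have hfin : {μ | A.eigenspace μ ≠ ⊥}.Finite := by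
    exact WellFoundedGT.finite_ne_bot_of_iSupIndep A.eigenspaces_iSupIndep
  have hμ : ∀ μ v, v ∈ A.eigenspace μ → v ≠ 0 → μ * starRingEnd ℂ μ = 1 := by
    intro μ v hv hv0
    have h1 : ∀ k : ℕ, (A ^ k) v = μ ^ k • v := by
      intro k
      induction k with
      | zero => simp
      | succ k ih => rw [pow_succ, Module.End.mul_apply, Module.End.mem_eigenspace_iff.1 hv,
          map_smul, ih, smul_smul, pow_succ, mul_comm]
    have h2 := h1 n
    rw [hA, Module.End.one_apply] at h2
    have h3 : μ ^ n = 1 := by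
      have : (μ ^ n - 1) • v = 0 := by rw [sub_smul, ← h2]; simp
      exact sub_eq_zero.1 ((smul_eq_zero.1 this).resolve_right hv0)
    rw [Complex.mul_conj, Complex.normSq_eq_norm_sq, Complex.norm_eq_one_of_pow_eq_one h3 hn]
    simp
  have hB : ∀ μ v, v ∈ A.eigenspace μ → B v = starRingEnd ℂ μ • v := by
    intro μ v hv
    by_cases hv0 : v = 0
    · simp [hv0]
    have h1 : B (A v) = v := by rw [← Module.End.mul_apply, hBA, Module.End.one_apply]
    rw [Module.End.mem_eigenspace_iff.1 hv, map_smul] at h1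
    calc B v = (starRingEnd ℂ μ * μ) • B v := by
            rw [mul_comm, hμ μ v hv hv0, one_smul]
      _ = _ := by rw [mul_smul, h1]
  have mA : ∀ μ, Set.MapsTo A (A.eigenspace μ) (A.eigenspace μ) := by
    intro μ v hv
    have hv' : v ∈ A.eigenspace μ := hv
    rw [Module.End.mem_eigenspace_iff.1 hv']
    exact (A.eigenspace μ).smul_mem _ hv
  have mB : ∀ μ, Set.MapsTo B (A.eigenspace μ) (A.eigenspace μ) := by
    intro μ v hv
    rw [hB μ v hv]
    exact (A.eigenspace μ).smul_mem _ hv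
  rw [LinearMap.trace_eq_sum_trace_restrict' hint hfin mA,
    LinearMap.trace_eq_sum_trace_restrict' hint hfin mB, map_sum]
  refine Finset.sum_congr rfl fun μ _ => ?_
  have e1 : A.restrict (mA μ) = μ • LinearMap.id := by
    exact LinearMap.ext fun v => Subtype.ext (Module.End.mem_eigenspace_iff.1 v.2)
  have e2 : B.restrict (mB μ) = starRingEnd ℂ μ • LinearMap.id := by
    exact LinearMap.ext fun v => Subtype.ext (hB μ v v.2)
  rw [e1, e2]
  simp

namespace IsIrrChar

variable {H : Type} [Group H] {f : H → ℂ}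

theorem isChar (hf : IsIrrChar H f) : IsChar H f := by
  obtain ⟨V, _, rfl⟩ := hf
  exact ⟨V, rfl⟩

end IsIrrChar

namespace IsChar

variable {H : Type} [Group H] {f : H → ℂ}

theorem conj_apply (hf : IsChar H f) (g h : H) : f (h * g * h⁻¹) = f g := by
  obtain ⟨V, rfl⟩ := hf
  exact V.char_conj g h

theorem inv_apply [Finite H] (hf : IsChar H f) (g : H) : f g⁻¹ = starRingEnd ℂ (f g) := by
  obtain ⟨V, rfl⟩ := hf
  refine trace_eq_conj_trace_of_pow_eq_one (orderOf_pos g).ne' ?_ ?_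
  · rw [← map_pow, pow_orderOf_eq_one, map_one]
  · rw [← map_mul, inv_mul_cancel, map_one]

theorem comp {K : Type} [Group K] (hf : IsChar H f) (φ : K →* H) : IsChar K (f ∘ φ) := by
  obtain ⟨V, rfl⟩ := hf
  exact ⟨FDRep.of (V.ρ.comp φ), rfl⟩

end IsChar

section orthogonality

variable {H : Type} [Group H] [Fintype H] {f f' : H → ℂ}

theorem isIrrChar_iff_sum_eq_card :
    IsIrrChar H f ↔ IsChar H f ∧ ∑ h, f h * f h⁻¹ = Nat.card H := by
  constructor
  · rintro ⟨V, hV, rfl⟩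
    exact ⟨⟨V, rfl⟩, V.simple_iff_char_is_norm_one.1 hV⟩
  · rintro ⟨⟨V, rfl⟩, hV⟩
    exact ⟨V, V.simple_iff_char_is_norm_one.2 hV, rfl⟩

theorem IsIrrChar.sum_eq_zero (hf : IsIrrChar H f) (hf' : IsIrrChar H f') (hne : f ≠ f') :
    ∑ h, f h * f' h⁻¹ = 0 := by
  obtain ⟨V, hV, rfl⟩ := hf
  obtain ⟨W, hW, rfl⟩ := hf'
  have hcard : (Nat.card H : ℂ) ≠ 0 := Nat.cast_ne_zero.2 Nat.card_pos.ne'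
  have := invertibleOfNonzero hcard
  have h := FDRep.char_orthonormal V W
  rw [if_neg] at h
  · exact (mul_eq_zero.1 h).resolve_left (inv_ne_zero hcard)
  · rintro ⟨i⟩
    exact hne (FDRep.char_iso i)

theorem IsChar.exists_nat_sum_eq (hf : IsChar H f) (hf' : IsChar H f') :
    ∃ m : ℕ, ∑ h, f h * f' h⁻¹ = Nat.card H * m := by
  obtain ⟨V, rfl⟩ := hf
  obtain ⟨W, rfl⟩ := hf'
  have hcard : (Nat.card H : ℂ) ≠ 0 := Nat.cast_ne_zero.2 Nat.card_pos.ne'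
  have := invertibleOfNonzero hcard
  have h := FDRep.scalar_product_char_eq_finrank_equivariant W V
  refine ⟨finrank ℂ (W ⟶ V), ?_⟩
  rw [← h, mul_inv_cancel_left₀ hcard]

theorem IsIrrChar.comp_mulEquiv {K : Type} [Group K] [Fintype K] (hf : IsIrrChar H f)
    (φ : K ≃* H) : IsIrrChar K (f ∘ φ) := by
  rw [isIrrChar_iff_sum_eq_card] at hf ⊢
  refine ⟨hf.1.comp φ.toMonoidHom, ?_⟩
  rw [Nat.card_congr φ.toEquiv, ← hf.2]
  exact Fintype.sum_equiv φ.toEquiv _ _ fun k => by simp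

theorem IsIrrChar.apply_one_ne_zero (hf : IsIrrChar H f) : f 1 ≠ 0 := by
  obtain ⟨h1, h2⟩ := isIrrChar_iff_sum_eq_card.1 hf
  obtain ⟨V, rfl⟩ := h1
  intro h0
  rw [FDRep.char_one, Nat.cast_eq_zero, Module.finrank_zero_iff] at h0
  have : ∀ h, V.character h = 0 := fun h => by
    have : V.ρ h = 0 := LinearMap.ext fun v => Subsingleton.elim _ _
    simp [FDRep.character, this]
  simp only [this, mul_zero, Finset.sum_const_zero] at h2
  exact Nat.card_pos.ne' (Nat.cast_eq_zero.1 h2.symm)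

end orthogonality

theorem FDRep.eq_smul_of_commute {H : Type} [Monoid H] (V : FDRep ℂ H)
    [CategoryTheory.Simple V] (E : V →ₗ[ℂ] V) (hE : ∀ h, E * V.ρ h = V.ρ h * E) :
    ∃ c : ℂ, E = c • (1 : Module.End ℂ V) := by
  have h1 := CategoryTheory.finrank_endomorphism_simple_eq_one ℂ V
  let F : V ⟶ V := ⟨CategoryTheory.InducedCategory.homMk (ModuleCat.ofHom E), fun h => by
    ext1
    exact hE h⟩
  obtain ⟨c, hc⟩ := (finrank_eq_one_iff_of_nonzero' (CategoryTheory.CategoryStruct.id V)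
    (CategoryTheory.id_nonzero V)).1 h1 F
  refine ⟨c, ?_⟩
  have := congrArg (fun f : V ⟶ V => (f.hom.hom.hom : V →ₗ[ℂ] V)) hc
  exact this.symm

theorem LinearMap.trace_eq_add_of_isCompl {K V : Type*} [Field K] [AddCommGroup V] [Module K V]
    [FiniteDimensional K V] {f : V →ₗ[K] V} {p q : Submodule K V} (hpq : IsCompl p q)
    (hp : Set.MapsTo f p p) (hq : Set.MapsTo f q q) :
    LinearMap.trace K V f =
      LinearMap.trace K p (f.restrict hp) + LinearMap.trace K q (f.restrict hq) := by
  rw [← LinearMap.trace_prodMap',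
    ← LinearMap.trace_conj' _ (Submodule.prodEquivOfIsCompl p q hpq)]
  congr 1
  refine LinearMap.ext fun v => ?_
  obtain ⟨w, rfl⟩ := (Submodule.prodEquivOfIsCompl p q hpq).surjective v
  simp [LinearEquiv.conj_apply]
  rfl

section decomposition

variable {H : Type} [Group H] [Fintype H]

theorem isIrrChar_character_of_isIrreducible {V : Type} [AddCommGroup V] [Module ℂ V]
    [FiniteDimensional ℂ V] (ρ : Representation ℂ H V) [ρ.IsIrreducible] :
    IsIrrChar H ρ.character := by
  have hcard : (Nat.card H : ℂ) ≠ 0 := Nat.cast_ne_zero.2 Nat.card_pos.ne'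
  have := invertibleOfNonzero hcard
  refine isIrrChar_iff_sum_eq_card.2 ⟨⟨FDRep.of ρ, rfl⟩, ?_⟩
  have h := Representation.char_orthonormal ρ ρ
  rw [if_pos ⟨Representation.Equiv.refl ρ⟩, inv_mul_eq_one₀ hcard] at h
  exact h.symm

theorem exists_isIrrChar_of_map_character_ne_zero (L : (H → ℂ) →ₗ[ℂ] ℂ) {V : Type}
    [AddCommGroup V] [Module ℂ V] [FiniteDimensional ℂ V] (ρ : Representation ℂ H V)
    (hL : L ρ.character ≠ 0) :
    ∃ g, IsIrrChar H g ∧ L g ≠ 0 ∧ ∑ h, g h * ρ.character h⁻¹ ≠ 0 := by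
  have hcard : (Nat.card H : ℂ) ≠ 0 := Nat.cast_ne_zero.2 Nat.card_pos.ne'
  induction hn : finrank ℂ V using Nat.strong_induction_on generalizing V with
  | _ n ih =>
  by_cases hirr : ρ.IsIrreducible
  · have hρ := isIrrChar_character_of_isIrreducible ρ
    exact ⟨_, hρ, hL, (isIrrChar_iff_sum_eq_card.1 hρ).2 ▸ hcard⟩
  have hV : Nontrivial V := by
    by_contra hV
    rw [not_nontrivial_iff_subsingleton] at hV
    apply hL
    have : ρ.character = 0 := funext fun h => by
      have : ρ h = 0 := LinearMap.ext fun v => Subsingleton.elim _ _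
      simp [Representation.character, this]
    rw [this, map_zero]
  have : Nontrivial (Subrepresentation ρ) := by
    refine ⟨⊥, ⊤, fun h => ?_⟩
    have := congrArg Subrepresentation.toSubmodule h
    exact bot_ne_top this
  obtain ⟨U, hU0, hU1⟩ : ∃ U : Subrepresentation ρ, U ≠ ⊥ ∧ U ≠ ⊤ := by
    by_contra! hc
    exact hirr ⟨fun U => or_iff_not_imp_left.2 (hc U)⟩
  obtain ⟨U', hc⟩ := exists_isCompl U
  have hcompl : IsCompl U.toSubmodule U'.toSubmodule := by
    constructor
    · rw [disjoint_iff, ← Subrepresentation.toSubmodule_inf, hc.inf_eq_bot]; rfl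
    · rw [codisjoint_iff, ← Subrepresentation.toSubmodule_sup, hc.sup_eq_top]; rfl
  have hchar : ρ.character = U.toRepresentation.character + U'.toRepresentation.character :=
    funext fun h => LinearMap.trace_eq_add_of_isCompl hcompl (U.apply_mem_toSubmodule h)
      (U'.apply_mem_toSubmodule h)
  have hUt : U.toSubmodule ≠ ⊤ := fun h => hU1 (Subrepresentation.toSubmodule_injective h)
  have hUt' : U'.toSubmodule ≠ ⊤ := fun h => hU0 (Subrepresentation.toSubmodule_injective (by
    have := hcompl.inf_eq_bot
    rwa [h, inf_top_eq] at this))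
  have h1 := Submodule.finrank_lt hUt
  have h2 := Submodule.finrank_lt hUt'
  have hUc : IsChar H U.toRepresentation.character := ⟨FDRep.of U.toRepresentation, rfl⟩
  have hUc' : IsChar H U'.toRepresentation.character := ⟨FDRep.of U'.toRepresentation, rfl⟩
  have hadd : ∀ g, IsIrrChar H g → (∑ h, g h * U.toRepresentation.character h⁻¹ ≠ 0 ∨
      ∑ h, g h * U'.toRepresentation.character h⁻¹ ≠ 0) → ∑ h, g h * ρ.character h⁻¹ ≠ 0 := by
    intro g hg hne
    obtain ⟨m, hm⟩ := hg.isChar.exists_nat_sum_eq hUc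
    obtain ⟨m', hm'⟩ := hg.isChar.exists_nat_sum_eq hUc'
    rw [hm, hm', mul_ne_zero_iff, mul_ne_zero_iff] at hne
    simp only [hchar, Pi.add_apply, mul_add, Finset.sum_add_distrib]
    rw [hm, hm', ← mul_add, ← Nat.cast_add]
    refine mul_ne_zero hcard (Nat.cast_ne_zero.2 ?_)
    simp only [ne_eq, Nat.cast_eq_zero] at hne
    omega
  have hL' := hL
  rw [hchar, map_add] at hL'
  by_cases h0 : L U.toRepresentation.character = 0
  · rw [h0, zero_add] at hL'
    obtain ⟨g, hg, hgL, hgs⟩ := ih _ (hn ▸ h2) _ hL' rfl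
    exact ⟨g, hg, hgL, hadd g hg (Or.inr hgs)⟩
  · obtain ⟨g, hg, hgL, hgs⟩ := ih _ (hn ▸ h1) _ h0 rfl
    exact ⟨g, hg, hgL, hadd g hg (Or.inl hgs)⟩

theorem IsChar.exists_isIrrChar_of_map_ne_zero {f : H → ℂ} (hf : IsChar H f)
    (L : (H → ℂ) →ₗ[ℂ] ℂ) (hL : L f ≠ 0) :
    ∃ g, IsIrrChar H g ∧ L g ≠ 0 ∧ ∑ h, g h * f h⁻¹ ≠ 0 := by
  obtain ⟨V, rfl⟩ := hf
  exact exists_isIrrChar_of_map_character_ne_zero L V.ρ hL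

/-- Every irreducible character of a subgroup is a constituent of the restriction of some
irreducible character of the whole group. -/
theorem IsIrrChar.exists_sum_mul_restrict_ne_zero {T : Subgroup H} {ψ : T → ℂ}
    (hψ : IsIrrChar T ψ) : ∃ χ, IsIrrChar H χ ∧ ∑ t : T, ψ t * χ (t : H)⁻¹ ≠ 0 := by
  obtain ⟨W, hW, rfl⟩ := hψ
  let R : Representation ℂ H (H → ℂ) :=
    { toFun := fun h => LinearMap.funLeft ℂ ℂ (fun g => g * h)
      map_one' := by ext; simp [LinearMap.funLeft]
      map_mul' := fun a b => by ext; simp [LinearMap.funLeft, mul_assoc] }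
  have hW1 : finrank ℂ W ≠ 0 := by
    have := IsIrrChar.apply_one_ne_zero (⟨W, hW, rfl⟩ : IsIrrChar T W.character)
    rw [FDRep.char_one] at this
    exact_mod_cast this
  have : Nontrivial W := Module.nontrivial_of_finrank_pos (R := ℂ) (Nat.pos_of_ne_zero hW1)
  obtain ⟨w, hw⟩ := exists_ne (0 : W)
  obtain ⟨l, hl⟩ := Module.Projective.exists_dual_ne_zero ℂ hw
  let F₀ : W →ₗ[ℂ] (H → ℂ) := LinearMap.pi fun g =>
    if hg : g ∈ T then l ∘ₗ W.ρ ⟨g, hg⟩ else 0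
  have hF₀ : ∀ (t : T) (v : W), F₀ (W.ρ t v) = R t (F₀ v) := by
    intro t v
    funext g
    change (if hg : g ∈ T then l ∘ₗ W.ρ ⟨g, hg⟩ else 0) (W.ρ t v) =
      (if hg : g * t ∈ T then l ∘ₗ W.ρ ⟨g * t, hg⟩ else 0) v
    by_cases hg : g ∈ T
    · rw [dif_pos hg, dif_pos (T.mul_mem hg t.2), LinearMap.comp_apply, LinearMap.comp_apply,
        ← Module.End.mul_apply, ← map_mul]
      rfl
    · rw [dif_neg hg, dif_neg (by rwa [T.mul_mem_cancel_right t.2])]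
      rfl
  let F : Representation.IntertwiningMap W.ρ (R.comp T.subtype) :=
    LinearMap.intertwiningMap_of_isIntertwiningMap _ _ F₀ hF₀
  have hF : F ≠ 0 := by
    intro h
    have h1 : F₀ w 1 = 0 := congrFun (congrArg (fun F => F.toLinearMap w) h) 1
    change (if hg : (1 : H) ∈ T then l ∘ₗ W.ρ ⟨1, hg⟩ else 0) w = 0 at h1
    rw [dif_pos T.one_mem, LinearMap.comp_apply, show (⟨1, T.one_mem⟩ : T) = 1 from rfl, map_one]
      at h1
    exact hl h1
  have hcard : (Nat.card T : ℂ) ≠ 0 := Nat.cast_ne_zero.2 Nat.card_pos.ne'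
  have := invertibleOfNonzero hcard
  have hsum := Representation.card_inv_mul_sum_char_mul_char_eq_finrank W.ρ (R.comp T.subtype)
  let L : (H → ℂ) →ₗ[ℂ] ℂ := ∑ t : T, W.character t⁻¹ • LinearMap.proj (t : H)
  have hL : ∀ f, L f = ∑ t : T, W.character t * f (t : H)⁻¹ := fun f => by
    rw [← Equiv.sum_comp (Equiv.inv T)]
    simp [L]
  have hLR : L R.character ≠ 0 := by
    intro h0
    have h1 : L R.character = ∑ t : T, Representation.character (R.comp T.subtype) t *
        Representation.character W.ρ t⁻¹ := by
      simp only [L, LinearMap.sum_apply, LinearMap.smul_apply, smul_eq_mul]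
      exact Finset.sum_congr rfl fun t _ => mul_comm _ _
    rw [← h1, h0, mul_zero, eq_comm, Nat.cast_eq_zero, Module.finrank_zero_iff] at hsum
    exact hF (Subsingleton.elim _ _)
  obtain ⟨χ, hχ, hχL, -⟩ := exists_isIrrChar_of_map_character_ne_zero L R hLR
  exact ⟨χ, hχ, hL χ ▸ hχL⟩

end decomposition

section convolution

variable {K H : Type*} [Group K] [Fintype K] [Group H]

/-- The convolution of a function on `H` with a function on `K`, along `ι : K →* H`. -/
def convAlong (ι : K →* H) (f : H → ℂ) (b : K → ℂ) : H → ℂ :=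
  fun h => ∑ k, f (h * ι k) * b k⁻¹

theorem convAlong_apply_one (ι : K →* H) (f : H → ℂ) (b : K → ℂ) :
    convAlong ι f b 1 = ∑ k, f (ι k) * b k⁻¹ := by
  simp [convAlong]

theorem convAlong_smul_left (ι : K →* H) (c : ℂ) (f : H → ℂ) (b : K → ℂ) :
    convAlong ι (c • f) b = c • convAlong ι f b := by
  funext h
  simp [convAlong, Finset.mul_sum, mul_assoc]

theorem convAlong_smul_right (ι : K →* H) (c : ℂ) (f : H → ℂ) (b : K → ℂ) :
    convAlong ι f (c • b) = c • convAlong ι f b := by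
  funext h
  simp [convAlong, Finset.mul_sum, mul_left_comm]

theorem convAlong_assoc (ι : K →* H) (f : H → ℂ) (a b : K → ℂ) :
    convAlong ι (convAlong ι f a) b = convAlong ι f (convAlong (MonoidHom.id K) a b) := by
  funext h
  simp only [convAlong, Finset.sum_mul, Finset.mul_sum, MonoidHom.id_apply]
  rw [Finset.sum_comm (γ := K)]
  rw [Finset.sum_comm]
  conv_rhs => rw [Finset.sum_comm]
  refine Finset.sum_congr rfl fun m _ => ?_
  rw [← Equiv.sum_comp (Equiv.mulLeft m⁻¹)]
  refine Finset.sum_congr rfl fun k _ => ?_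
  simp [mul_assoc]

end convolution

/-- Convolving an irreducible character of `H` with an `H`-invariant function on `K` multiplies it
by a scalar. -/
theorem IsIrrChar.convAlong_eq_smul {K H : Type} [Group K] [Fintype K] [Group H] [Fintype H]
    {ψ : H → ℂ} (hψ : IsIrrChar H ψ) (ι : K →* H) {b : K → ℂ}
    (hb : ∀ h, ∃ σ : K ≃ K, ∀ k, ι (σ k) = h * ι k * h⁻¹ ∧ b (σ k)⁻¹ = b k⁻¹) :
    convAlong ι ψ b = (convAlong ι ψ b 1 / ψ 1) • ψ := by
  have h1 := hψ.apply_one_ne_zero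
  obtain ⟨W, hW, rfl⟩ := hψ
  let E : Module.End ℂ W := ∑ k, b k⁻¹ • W.ρ (ι k)
  have hE : ∀ h, E * W.ρ h = W.ρ h * E := by
    intro h
    obtain ⟨σ, hσ⟩ := hb h
    simp only [E, Finset.sum_mul, Finset.mul_sum]
    rw [← Equiv.sum_comp σ]
    refine Finset.sum_congr rfl fun k _ => ?_
    rw [(hσ k).1, (hσ k).2, smul_mul_assoc, mul_smul_comm, ← map_mul, ← map_mul]
    simp
  obtain ⟨c, hc⟩ := FDRep.eq_smul_of_commute W E hE
  have hconv : convAlong ι W.character b = c • W.character := by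
    funext h
    have h2 : LinearMap.trace ℂ W (W.ρ h * E) = c * W.character h := by
      rw [hc, mul_smul_comm, mul_one, map_smul]
      rfl
    rw [Pi.smul_apply, smul_eq_mul, ← h2]
    simp only [E, Finset.mul_sum, map_sum, convAlong, mul_smul_comm, map_smul, ← map_mul]
    exact Finset.sum_congr rfl fun k _ => mul_comm _ _
  rw [hconv, Pi.smul_apply, smul_eq_mul, mul_div_cancel_right₀ _ h1]

section convolution

variable {K : Type} [Group K] [Fintype K] {θ θ' : K → ℂ}

theorem IsIrrChar.convAlong_id_eq_smul (hθ : IsIrrChar K θ) (hθ' : IsIrrChar K θ') :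
    convAlong (MonoidHom.id K) θ θ' = ((∑ k, θ k * θ' k⁻¹) / θ 1) • θ := by
  have h := hθ.convAlong_eq_smul (MonoidHom.id K) (b := θ') fun h =>
    ⟨(MulAut.conj h).toEquiv, fun k => ⟨by simp, by
      have := hθ'.isChar.conj_apply k⁻¹ h
      simpa [mul_assoc] using this⟩⟩
  rwa [convAlong_apply_one] at h

theorem IsIrrChar.convAlong_id_self (hθ : IsIrrChar K θ) :
    convAlong (MonoidHom.id K) θ θ = (Nat.card K / θ 1 : ℂ) • θ := by
  rw [hθ.convAlong_id_eq_smul hθ, (isIrrChar_iff_sum_eq_card.1 hθ).2]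

theorem IsIrrChar.convAlong_id_of_ne (hθ : IsIrrChar K θ) (hθ' : IsIrrChar K θ') (h : θ ≠ θ') :
    convAlong (MonoidHom.id K) θ θ' = 0 := by
  rw [hθ.convAlong_id_eq_smul hθ', hθ.sum_eq_zero hθ' h, zero_div, zero_smul]

end convolution

theorem charInner_eq_sum_mul_inv {K : Type} [Group K] [Fintype K] {θ : K → ℂ} (hθ : IsChar K θ)
    (f : K → ℂ) : charInner K f θ = (Nat.card K : ℂ)⁻¹ * ∑ k, f k * θ k⁻¹ := by
  simp only [charInner, Nat.card_eq_fintype_card, hθ.inv_apply]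

theorem charInner_ne_zero_iff {K : Type} [Group K] [Fintype K] {θ : K → ℂ} (hθ : IsChar K θ)
    (f : K → ℂ) : charInner K f θ ≠ 0 ↔ ∑ k, f k * θ k⁻¹ ≠ 0 := by
  rw [charInner_eq_sum_mul_inv hθ, mul_ne_zero_iff]
  simp

section induction

variable {G : Type*} [Group G] [Fintype G] {T : Subgroup G}

theorem indChar_conj (f : T → ℂ) (g h : G) : indChar T f (h * g * h⁻¹) = indChar T f g := by
  unfold indChar
  congr 1
  rw [← Equiv.sum_comp (Equiv.mulRight h) fun x =>
    if hx : x * g * x⁻¹ ∈ T then f ⟨x * g * x⁻¹, hx⟩ else 0]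
  refine Finset.sum_congr rfl fun x _ => ?_
  have : x * (h * g * h⁻¹) * x⁻¹ = Equiv.mulRight h x * g * (Equiv.mulRight h x)⁻¹ := by
    simp [mul_assoc]
  simp only [this]

theorem indChar_inv {f : T → ℂ} (hf : ∀ t, f t⁻¹ = starRingEnd ℂ (f t)) (g : G) :
    indChar T f g⁻¹ = starRingEnd ℂ (indChar T f g) := by
  simp only [indChar, map_mul, map_inv₀, Complex.conj_natCast, map_sum]
  congr 1
  refine Finset.sum_congr rfl fun x _ => ?_
  have h1 : x * g⁻¹ * x⁻¹ = (x * g * x⁻¹)⁻¹ := by group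
  simp only [h1]
  by_cases h : x * g * x⁻¹ ∈ T
  · rw [dif_pos h, dif_pos (T.inv_mem h), ← hf]
    rfl
  · rw [dif_neg h, dif_neg (by rwa [T.inv_mem_iff]), map_zero]

/-- Frobenius reciprocity. -/
theorem sum_indChar_mul_inv (f : T → ℂ) {φ : G → ℂ} (hφ : ∀ g h, φ (h * g * h⁻¹) = φ g) :
    ∑ g, indChar T f g * φ g⁻¹ =
      (Nat.card T : ℂ)⁻¹ * Nat.card G * ∑ t : T, f t * φ (t : G)⁻¹ := by
  have h1 : ∀ x : G, ∑ g, (if h : x * g * x⁻¹ ∈ T then f ⟨x * g * x⁻¹, h⟩ else 0) * φ g⁻¹ =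
      ∑ t : T, f t * φ (t : G)⁻¹ := by
    intro x
    have h2 : ∀ g, φ g⁻¹ = φ (x * g * x⁻¹)⁻¹ := fun g => by
      rw [← hφ g⁻¹ x]
      congr 1
      group
    rw [Finset.sum_congr rfl fun g _ => congrArg _ (h2 g)]
    refine (Equiv.sum_comp (MulAut.conj x).toEquiv
      fun g => (if h : g ∈ T then f ⟨g, h⟩ else 0) * φ g⁻¹).trans ?_
    refine (Fintype.sum_of_injective _ Subtype.val_injective _ _ (fun g hg => ?_) fun t => ?_).symm
    · rw [dif_neg (by simpa using hg), zero_mul]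
    · rw [dif_pos t.2]
  unfold indChar
  simp_rw [mul_assoc (Nat.card T : ℂ)⁻¹, ← Finset.mul_sum, Finset.sum_mul]
  rw [Finset.sum_comm, Finset.sum_congr rfl fun x _ => h1 x]
  simp

end induction

/-- A function with `f g⁻¹ = conj (f g)` which has the norm of `χ` and a positive integral inner
product with `χ` is equal to `χ`. -/
theorem IsIrrChar.eq_of_sum_eq_card {G : Type} [Group G] [Fintype G] {f χ : G → ℂ}
    (hχ : IsIrrChar G χ) (hf : ∀ g, f g⁻¹ = starRingEnd ℂ (f g))
    (hff : ∑ g, f g * f g⁻¹ = Nat.card G) {m : ℕ} (hm : m ≠ 0)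
    (hfχ : ∑ g, f g * χ g⁻¹ = Nat.card G * m) : f = χ := by
  have hχf : ∑ g, χ g * f g⁻¹ = Nat.card G * m := by
    rw [← hfχ, ← Equiv.sum_comp (Equiv.inv G)]
    simp [mul_comm]
  have hsum : ∑ g, (f g - χ g) * (f g⁻¹ - χ g⁻¹) = Nat.card G * (2 - 2 * m) := by
    simp only [sub_mul, mul_sub, Finset.sum_sub_distrib]
    rw [hff, hfχ, hχf, (isIrrChar_iff_sum_eq_card.1 hχ).2]
    ring
  have hreal : ∑ g, Complex.normSq (f g - χ g) = Nat.card G * (2 - 2 * m) := by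
    apply Complex.ofReal_injective
    push_cast
    rw [← hsum]
    refine Finset.sum_congr rfl fun g _ => ?_
    rw [hf, hχ.isChar.inv_apply, ← map_sub, Complex.mul_conj]
  have hm1 : (1 : ℝ) ≤ m := by exact_mod_cast Nat.one_le_iff_ne_zero.2 hm
  have hle : ∑ g, Complex.normSq (f g - χ g) ≤ 0 := by
    rw [hreal]
    exact mul_nonpos_of_nonneg_of_nonpos (Nat.cast_nonneg _) (by linarith)
  have hnn : ∀ g ∈ Finset.univ, 0 ≤ Complex.normSq (f g - χ g) := fun g _ => Complex.normSq_nonneg _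
  have h0 := (Finset.sum_eq_zero_iff_of_nonneg hnn).1 (le_antisymm hle (Finset.sum_nonneg hnn))
  exact funext fun g => sub_eq_zero.1 (Complex.normSq_eq_zero.1 (h0 g (Finset.mem_univ g)))

section clifford

variable {G : Type} [Group G] [Fintype G] {N : Subgroup G} [N.Normal] {θ : N → ℂ}

theorem IsIrrChar.conjChar (hθ : IsIrrChar N θ) (x : G) : IsIrrChar N (conjChar N x θ) :=
  hθ.comp_mulEquiv (MulAut.conjNormal x)

theorem IsIrrChar.convAlong_inclusion_eq_smul (hNT : N ≤ inertia N θ) {ψ : inertia N θ → ℂ}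
    (hψ : IsIrrChar (inertia N θ) ψ) :
    convAlong (Subgroup.inclusion hNT) ψ θ =
      (convAlong (Subgroup.inclusion hNT) ψ θ 1 / ψ 1) • ψ :=
  hψ.convAlong_eq_smul _ fun t => ⟨(MulAut.conjNormal (t : G)).toEquiv, fun k =>
    ⟨rfl, by
      have h : _root_.conjChar N (t : G) θ = θ := t.2
      have h1 := congrFun h k⁻¹
      rw [← h1, _root_.conjChar]
      congr 1
      ext
      simp [mul_assoc]⟩⟩

theorem convAlong_inclusion_of_lies_over (hθ : IsIrrChar N θ) (hNT : N ≤ inertia N θ)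
    {ψ : inertia N θ → ℂ} (hψ : IsIrrChar (inertia N θ) ψ)
    (hover : ∑ n : N, ψ (Subgroup.inclusion hNT n) * θ n⁻¹ ≠ 0) :
    convAlong (Subgroup.inclusion hNT) ψ θ = (Nat.card N / θ 1 : ℂ) • ψ := by
  have h1 := hψ.apply_one_ne_zero
  have hc := hψ.convAlong_inclusion_eq_smul hNT
  have hc0 : convAlong (Subgroup.inclusion hNT) ψ θ 1 / ψ 1 ≠ 0 :=
    div_ne_zero (by rwa [convAlong_apply_one]) h1
  set c := convAlong (Subgroup.inclusion hNT) ψ θ 1 / ψ 1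
  have h2 := convAlong_assoc (Subgroup.inclusion hNT) ψ θ θ
  rw [hθ.convAlong_id_self, convAlong_smul_right, hc, convAlong_smul_left, hc] at h2
  have h3 := congrFun h2 1
  simp only [Pi.smul_apply, smul_eq_mul] at h3
  have h4 : c = Nat.card N / θ 1 := by
    exact mul_right_cancel₀ (mul_ne_zero hc0 h1) h3
  rw [hc, h4]

theorem convAlong_inclusion_conjChar (hθ : IsIrrChar N θ) (hNT : N ≤ inertia N θ)
    {ψ : inertia N θ → ℂ} (hψ : IsIrrChar (inertia N θ) ψ)
    (hover : ∑ n : N, ψ (Subgroup.inclusion hNT n) * θ n⁻¹ ≠ 0)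
    {x : G} (hx : x ∉ inertia N θ) :
    convAlong (Subgroup.inclusion hNT) ψ (conjChar N x θ) = 0 := by
  have hd : (Nat.card N / θ 1 : ℂ) ≠ 0 :=
    div_ne_zero (Nat.cast_ne_zero.2 Nat.card_pos.ne') hθ.apply_one_ne_zero
  have h2 := convAlong_assoc (Subgroup.inclusion hNT) ψ θ (conjChar N x θ)
  rw [hθ.convAlong_id_of_ne (hθ.conjChar x) fun h => hx h.symm,
    convAlong_inclusion_of_lies_over hθ hNT hψ hover, convAlong_smul_left] at h2
  refine (smul_eq_zero.1 (h2.trans ?_)).resolve_left hd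
  funext t
  simp [convAlong]

theorem convAlong_indChar (hθ : IsIrrChar N θ) (hNT : N ≤ inertia N θ)
    {ψ : inertia N θ → ℂ} (hψ : IsIrrChar (inertia N θ) ψ)
    (hover : ∑ n : N, ψ (Subgroup.inclusion hNT n) * θ n⁻¹ ≠ 0)
    (t : inertia N θ) :
    convAlong N.subtype (indChar (inertia N θ) ψ) θ t = (Nat.card N / θ 1 : ℂ) * ψ t := by
  have hcard : (Nat.card (inertia N θ) : ℂ) ≠ 0 := Nat.cast_ne_zero.2 Nat.card_pos.ne'
  have key : ∀ x : G, ∑ n : N, (if h : x * (t * n) * x⁻¹ ∈ inertia N θ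
      then ψ ⟨x * (t * n) * x⁻¹, h⟩ else 0) * θ n⁻¹ =
      if x ∈ inertia N θ then (Nat.card N / θ 1 : ℂ) * ψ t else 0 := by
    intro x
    have hmul : ∀ n : N, x * (t * n) * x⁻¹ = x * t * x⁻¹ * (MulAut.conjNormal x n : N) := by
      intro n
      simp [mul_assoc]
    have hmem : ∀ n : N, x * (t * n) * x⁻¹ ∈ inertia N θ ↔ x * t * x⁻¹ ∈ inertia N θ := by
      intro n
      rw [hmul, Subgroup.mul_mem_cancel_right _ (hNT (Subtype.prop _))]
    by_cases hs : x * t * x⁻¹ ∈ inertia N θ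
    · have hconv : ∑ n : N, (if h : x * (t * n) * x⁻¹ ∈ inertia N θ
          then ψ ⟨x * (t * n) * x⁻¹, h⟩ else 0) * θ n⁻¹ =
          convAlong (Subgroup.inclusion hNT) ψ (conjChar N x⁻¹ θ) ⟨_, hs⟩ := by
        unfold convAlong
        rw [← Equiv.sum_comp (MulAut.conjNormal x : MulAut N).toEquiv fun n =>
          ψ (⟨x * t * x⁻¹, hs⟩ * Subgroup.inclusion hNT n) * conjChar N x⁻¹ θ n⁻¹]
        refine Finset.sum_congr rfl fun n _ => ?_
        rw [dif_pos ((hmem n).2 hs)]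
        congr 2
        · exact Subtype.ext (hmul n)
        · ext
          simp [mul_assoc]
      rw [hconv]
      split_ifs with hx
      · have h1 : conjChar N x⁻¹ θ = θ := (inertia N θ).inv_mem hx
        rw [h1, convAlong_inclusion_of_lies_over hθ hNT hψ hover, Pi.smul_apply, smul_eq_mul]
        congr 1
        exact hψ.isChar.conj_apply t ⟨x, hx⟩
      · rw [convAlong_inclusion_conjChar hθ hNT hψ hover (by rwa [Subgroup.inv_mem_iff])]
        rfl
    · have hx : x ∉ inertia N θ := fun hx => hs
        ((inertia N θ).mul_mem ((inertia N θ).mul_mem hx t.2) ((inertia N θ).inv_mem hx))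
      rw [if_neg hx]
      refine Finset.sum_eq_zero fun n _ => ?_
      rw [dif_neg ((hmem n).not.2 hs), zero_mul]
  unfold convAlong indChar
  simp_rw [mul_assoc (Nat.card (inertia N θ) : ℂ)⁻¹, ← Finset.mul_sum, Finset.sum_mul]
  rw [Finset.sum_comm]
  refine (congrArg _ (Finset.sum_congr rfl fun x _ => key x)).trans ?_
  rw [Finset.sum_ite, Finset.sum_const_zero, add_zero, Finset.sum_const, nsmul_eq_mul,
    ← Fintype.card_subtype, ← Nat.card_eq_fintype_card]
  exact inv_mul_cancel_left₀ hcard _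

theorem sum_indChar_mul_indChar_inv (hθ : IsIrrChar N θ) (hNT : N ≤ inertia N θ)
    {ψ : inertia N θ → ℂ} (hψ : IsIrrChar (inertia N θ) ψ)
    (hover : ∑ n : N, ψ (Subgroup.inclusion hNT n) * θ n⁻¹ ≠ 0) :
    ∑ g, indChar (inertia N θ) ψ g * indChar (inertia N θ) ψ g⁻¹ = Nat.card G := by
  have hcard : (Nat.card (inertia N θ) : ℂ) ≠ 0 := Nat.cast_ne_zero.2 Nat.card_pos.ne'
  have hd : (Nat.card N / θ 1 : ℂ) ≠ 0 :=
    div_ne_zero (Nat.cast_ne_zero.2 Nat.card_pos.ne') hθ.apply_one_ne_zero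
  set R := indChar (inertia N θ) ψ with hR
  have hRc : ∀ g h, R (h * g * h⁻¹) = R g := indChar_conj ψ
  have hswap : ∑ t, convAlong (Subgroup.inclusion hNT) ψ θ t * R (t : G)⁻¹ =
      ∑ t : inertia N θ, ψ t * convAlong N.subtype R θ (t : G)⁻¹ := by
    simp only [convAlong, Finset.sum_mul, Finset.mul_sum]
    rw [Finset.sum_comm]
    conv_rhs => rw [Finset.sum_comm]
    refine Finset.sum_congr rfl fun n _ => ?_
    rw [← Equiv.sum_comp (Equiv.mulRight (Subgroup.inclusion hNT n))
      fun t : inertia N θ => ψ t * (R ((t : G)⁻¹ * N.subtype n) * θ n⁻¹)]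
    refine Finset.sum_congr rfl fun t _ => ?_
    have : ((Equiv.mulRight (Subgroup.inclusion hNT n) t : inertia N θ) : G)⁻¹ * N.subtype n =
        (n : G)⁻¹ * (t : G)⁻¹ * ((n : G)⁻¹)⁻¹ := by
      simp
    rw [this, hRc, Equiv.coe_mulRight]
    ring
  have h2 : ∀ t : inertia N θ, convAlong N.subtype R θ (t : G)⁻¹ =
      (Nat.card N / θ 1 : ℂ) * ψ t⁻¹ := fun t => convAlong_indChar hθ hNT hψ hover t⁻¹
  simp only [h2, convAlong_inclusion_of_lies_over hθ hNT hψ hover, Pi.smul_apply, smul_eq_mul,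
    mul_assoc, mul_left_comm (ψ _), ← Finset.mul_sum] at hswap
  rw [hR, sum_indChar_mul_inv ψ hRc, mul_left_cancel₀ hd hswap,
    (isIrrChar_iff_sum_eq_card.1 hψ).2]
  field_simp

theorem indChar_eq_of_sum_mul_restrict_ne_zero (hθ : IsIrrChar N θ) (hNT : N ≤ inertia N θ)
    {ψ : inertia N θ → ℂ} (hψ : IsIrrChar (inertia N θ) ψ)
    (hover : ∑ n : N, ψ (Subgroup.inclusion hNT n) * θ n⁻¹ ≠ 0)
    {χ : G → ℂ} (hχ : IsIrrChar G χ)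
    (h : ∑ t : inertia N θ, ψ t * χ (t : G)⁻¹ ≠ 0) : indChar (inertia N θ) ψ = χ := by
  have hcard : (Nat.card (inertia N θ) : ℂ) ≠ 0 := Nat.cast_ne_zero.2 Nat.card_pos.ne'
  obtain ⟨m, hm⟩ := hψ.isChar.exists_nat_sum_eq (hχ.isChar.comp (inertia N θ).subtype)
  change ∑ t : inertia N θ, ψ t * χ (t : G)⁻¹ = _ at hm
  refine hχ.eq_of_sum_eq_card (indChar_inv hψ.isChar.inv_apply)
    (sum_indChar_mul_indChar_inv hθ hNT hψ hover) (m := m) ?_ ?_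
  · rintro rfl
    simp [hm] at h
  · rw [sum_indChar_mul_inv ψ hχ.isChar.conj_apply, hm]
    field_simp

end clifford

end

/-- Clifford correspondence: induction is a bijection between the irreducible characters
of the inertia group `T = G_θ` lying over `θ` and the irreducible characters of `G`
lying over `θ`. -/
theorem clifford_correspondence (G : Type) [Group G] [Fintype G] (N : Subgroup G)
    [N.Normal] (θ : N → ℂ) (hθ : IsIrrChar N θ)
    (hNT : N ≤ inertia N θ) :
    Set.BijOn (indChar (inertia N θ))
      {ψ : inertia N θ → ℂ | IsIrrChar (inertia N θ) ψ ∧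
        charInner N (fun n : N => ψ ⟨(n : G), hNT n.2⟩) θ ≠ 0}
      {χ : G → ℂ | IsIrrChar G χ ∧ charInner N (fun n : N => χ n) θ ≠ 0} := by
  have hd : (Nat.card N / θ 1 : ℂ) ≠ 0 :=
    div_ne_zero (Nat.cast_ne_zero.2 Nat.card_pos.ne') hθ.apply_one_ne_zero
  simp only [charInner_ne_zero_iff hθ.isChar]
  refine ⟨?_, ?_, ?_⟩
  · rintro ψ ⟨hψ, hover⟩
    obtain ⟨χ, hχ, h⟩ := hψ.exists_sum_mul_restrict_ne_zero
    refine ⟨indChar_eq_of_sum_mul_restrict_ne_zero hθ hNT hψ hover hχ h ▸ hχ, ?_⟩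
    have h1 := convAlong_indChar hθ hNT hψ hover 1
    rw [Subgroup.coe_one, convAlong_apply_one] at h1
    exact h1 ▸ mul_ne_zero hd hψ.apply_one_ne_zero
  · rintro ψ ⟨hψ, hover⟩ ψ' ⟨hψ', hover'⟩ h
    funext t
    refine mul_left_cancel₀ hd ?_
    rw [← convAlong_indChar hθ hNT hψ hover, ← convAlong_indChar hθ hNT hψ' hover', h]
  · rintro χ ⟨hχ, hover⟩
    let L : (inertia N θ → ℂ) →ₗ[ℂ] ℂ :=
      ∑ n : N, θ n⁻¹ • LinearMap.proj (Subgroup.inclusion hNT n)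
    have hL : ∀ f, L f = ∑ n : N, f (Subgroup.inclusion hNT n) * θ n⁻¹ := fun f => by
      simp [L, mul_comm]
    obtain ⟨ψ, hψ, hψL, h⟩ :=
      (hχ.isChar.comp (inertia N θ).subtype).exists_isIrrChar_of_map_ne_zero L
        (by rw [hL]; exact hover)
    rw [hL] at hψL
    exact ⟨ψ, ⟨hψ, hψL⟩, indChar_eq_of_sum_mul_restrict_ne_zero hθ hNT hψ hψL hχ h⟩
end

section
/- Let G be a finite group whose order is p^a·q^b for primes p and q. Then G is solvable. -/
theorem forall_eq_of_card_mul_eq_sum {s : Multiset ℂ} (hs : ∀ z ∈ s, ‖z‖ = 1) {α : ℂ}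
    (hα : ‖α‖ = 1) (hsum : s.card * α = s.sum) : ∀ z ∈ s, z = α := by
  by_contra! ⟨w, hw, hwα⟩
  have key (z : ℂ) (hz : z ∈ s) : ‖z - α‖ ^ 2 = 2 - 2 * inner ℝ α z := by
    rw [norm_sub_sq_real, hs z hz, hα, real_inner_comm]; ring
  have hlt : (s.map fun z => inner ℝ α z).sum < (s.map fun _ => (1 : ℝ)).sum := by
    refine Multiset.sum_lt_sum (fun z hz => ?_) ⟨w, hw, ?_⟩
    · nlinarith [key z hz, sq_nonneg ‖z - α‖]
    · have : 0 < ‖w - α‖ ^ 2 := by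
        have := norm_pos_iff.2 (sub_ne_zero.2 hwα)
        positivity
      linarith [key w hw]
  have h1 : (s.map fun z => inner ℝ α z).sum = inner ℝ α s.sum :=
    (map_multiset_sum (innerₛₗ ℝ α) s).symm
  have h2 : inner ℝ α s.sum = s.card := by
    rw [← hsum, ← nsmul_eq_mul, ← Nat.cast_smul_eq_nsmul ℝ, real_inner_smul_right,
      real_inner_self_eq_norm_sq, hα]
    simp
  rw [h1, h2] at hlt
  simp at hlt

theorem eq_zero_or_forall_eq_of_isIntegral_average {s : Multiset ℂ} {n : ℕ} (hn : n ≠ 0)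
    (hs : ∀ z ∈ s, z ^ n = 1) {α : ℂ} (hα : s.card * α = s.sum) (hint : IsIntegral ℤ α) :
    α = 0 ∨ ∀ z ∈ s, z = α := by
  rcases eq_or_ne s 0 with rfl | hs0
  · simp
  have hcard : (0 : ℝ) < s.card := by exact_mod_cast Multiset.card_pos.2 hs0
  refine or_iff_not_imp_left.2 fun hα0 => ?_
  let R : Set ℂ := {z | z ^ n = 1}
  have hR : R.Finite := by
    refine ((Polynomial.nthRoots n (1 : ℂ)).toFinset.finite_toSet).subset fun z hz => ?_
    simpa [R, Polynomial.mem_nthRoots (Nat.pos_of_ne_zero hn)] using hz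
  let K := IntermediateField.adjoin ℚ R
  have : FiniteDimensional ℚ K := by
    have := hR.to_subtype
    refine IntermediateField.finiteDimensional_adjoin fun z hz => ?_
    exact IsIntegral.of_pow (Nat.pos_of_ne_zero hn) (by rw [hz]; exact isIntegral_one)
  have : NumberField K := ⟨⟩
  have hsK : ∀ z ∈ s, z ∈ K := fun z hz => IntermediateField.subset_adjoin ℚ R (hs z hz)
  lift s to Multiset K using hsK
  have hsum : (s.card : ℂ) * α = (s.sum : K) := by
    simpa [map_multiset_sum] using hα
  have hcard' : (s.card : ℂ) ≠ 0 := by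
    simpa using hcard.ne'
  have hαK : α ∈ K := by
    have : α = (s.sum / (s.card : K) : K) := by
      rw [IntermediateField.coe_div, ← hsum]
      push_cast
      field_simp
    rw [this]; exact SetLike.coe_mem _
  lift α to K using hαK
  have hsumK : (s.card : K) * α = s.sum := by exact_mod_cast hsum
  have hsK (z : K) (hz : z ∈ s) : z ^ n = 1 := by
    have := hs z (Multiset.mem_map_of_mem _ hz)
    exact_mod_cast this
  have hnorm (φ : K →+* ℂ) : ‖φ α‖ ≤ 1 := by
    have h1 : (s.card : ℂ) * φ α = (s.map φ).sum := by
      rw [← map_multiset_sum, ← hsumK]; simp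
    have h2 : ‖(s.map φ).sum‖ ≤ s.card := by
      refine (norm_multiset_sum_le _).trans ?_
      rw [Multiset.map_map]
      refine (Multiset.sum_le_card_nsmul _ 1 ?_).trans (by simp)
      simp only [Multiset.mem_map, Function.comp]
      rintro _ ⟨z, hz, rfl⟩
      exact (Complex.norm_eq_one_of_pow_eq_one (by rw [← map_pow, hsK z hz, map_one]) hn).le
    rw [← h1, norm_mul, Complex.norm_natCast] at h2
    have hc : (0 : ℝ) < s.card := by simpa using hcard
    exact le_of_mul_le_mul_left (by simpa using h2) hc
  have hαint : IsIntegral ℤ α := (isIntegral_algebraMap_iff (B := ℂ)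
    (algebraMap K ℂ).injective).1 hint
  obtain ⟨m, hm, hαm⟩ := NumberField.Embeddings.pow_eq_one_of_norm_le_one K ℂ
    (by simpa using hα0) hαint hnorm
  have hα1 : ‖(α : ℂ)‖ = 1 :=
    Complex.norm_eq_one_of_pow_eq_one (n := m) (by exact_mod_cast congrArg (algebraMap K ℂ) hαm)
      hm.ne'
  exact forall_eq_of_card_mul_eq_sum
    (fun z hz => Complex.norm_eq_one_of_pow_eq_one (hs z hz) hn) hα1 hα

theorem eq_scalar_of_pow_eq_one {d n : ℕ} (hn : n ≠ 0) {M : Matrix (Fin d) (Fin d) ℂ}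
    (hM : M ^ n = 1) {α : ℂ} (h : ∀ z ∈ M.charpoly.roots, z = α) :
    M = algebraMap ℂ _ α := by
  open Polynomial in
  have h1 : minpoly ℂ M ∣ X ^ n - 1 := minpoly.dvd _ _ (by simp [hM])
  have hsq : Squarefree (minpoly ℂ M) := by
    refine Squarefree.squarefree_of_dvd h1 (Separable.squarefree ?_)
    exact (X_pow_sub_one_separable_iff (n := n)).2 (by exact_mod_cast hn)
  have hc : M.charpoly = (X - C α) ^ d := by
    have := (IsAlgClosed.splits M.charpoly).eq_prod_roots
    rw [Multiset.eq_replicate_of_mem h,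
      (IsAlgClosed.splits M.charpoly).natDegree_eq_card_roots.symm] at this
    simpa [M.charpoly_monic.leadingCoeff] using this
  have h2 : minpoly ℂ M ∣ (X - C α) ^ (d + 1) :=
    (hc ▸ M.minpoly_dvd_charpoly).trans (pow_dvd_pow _ d.le_succ)
  rw [hsq.dvd_pow_iff_dvd d.succ_ne_zero, minpoly.dvd_iff] at h2
  simpa [sub_eq_zero] using h2

theorem pow_eq_one_of_mem_roots_charpoly {d n : ℕ} {M : Matrix (Fin d) (Fin d) ℂ}
    (hM : M ^ n = 1) {z : ℂ} (hz : z ∈ M.charpoly.roots) : z ^ n = 1 := by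
  have h1 : z ∈ spectrum ℂ M :=
    Matrix.mem_spectrum_iff_isRoot_charpoly.2 (Polynomial.isRoot_of_mem_roots hz)
  have := spectrum.pow_mem_pow M n h1
  rw [hM] at this
  rcases d with _ | d
  · simp [Matrix.charpoly] at hz
  · rw [spectrum.one_eq] at this; simpa using this

theorem trace_mulLeft_pi_matrix {ι : Type*} [Fintype ι] [DecidableEq ι] (d : ι → ℕ)
    (A : Π i, Matrix (Fin (d i)) (Fin (d i)) ℂ) :
    LinearMap.trace ℂ _ (LinearMap.mulLeft ℂ A) = ∑ i, d i * (A i).trace := by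
  rw [LinearMap.trace_eq_matrix_trace ℂ
    (Pi.basis fun i => Matrix.stdBasis ℂ (Fin (d i)) (Fin (d i))), Matrix.trace, Fintype.sum_sigma]
  refine Finset.sum_congr rfl fun i _ => ?_
  have h (B : Matrix (Fin (d i)) (Fin (d i)) ℂ) (x : Fin (d i) × Fin (d i)) :
      (Matrix.stdBasis ℂ (Fin (d i)) (Fin (d i))).repr B x = B x.1 x.2 := rfl
  simp only [Matrix.diag_apply, LinearMap.toMatrix_apply, Pi.basis_repr, Pi.basis_apply,
    Matrix.stdBasis_eq_single, LinearMap.mulLeft_apply, h,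
    Fintype.sum_prod_type]
  simp [Matrix.trace, Finset.mul_sum]

theorem trace_mulLeft_single {G : Type*} [Group G] [Fintype G] {g : G} (hg : g ≠ 1) :
    LinearMap.trace ℂ _ (LinearMap.mulLeft ℂ (MonoidAlgebra.single g (1 : ℂ))) = 0 := by
  classical
  rw [LinearMap.trace_eq_matrix_trace ℂ (MonoidAlgebra.basis G ℂ), Matrix.trace]
  refine Finset.sum_eq_zero fun x _ => ?_
  simp only [Matrix.diag_apply, LinearMap.toMatrix_apply, LinearMap.mulLeft_apply]
  have h : MonoidAlgebra.basis G ℂ x = .single x 1 := rfl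
  rw [h, MonoidAlgebra.single_mul_single]
  change (MonoidAlgebra.single (g * x) (1 * 1 : ℂ)).coeff x = 0
  simp [hg]

section

variable {G : Type*} [Group G] {d : ℕ}
  {π : MonoidAlgebra ℂ G →ₐ[ℂ] Matrix (Fin d) (Fin d) ℂ}

theorem pow_card_map_single [Fintype G]
    (π : MonoidAlgebra ℂ G →ₐ[ℂ] Matrix (Fin d) (Fin d) ℂ) (g : G) : π (.single g 1) ^ Fintype.card G = 1 := by
  rw [← map_pow, MonoidAlgebra.single_pow, pow_card_eq_one, one_pow]
  exact map_one π

theorem isIntegral_trace_map_single [Fintype G]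
    (π : MonoidAlgebra ℂ G →ₐ[ℂ] Matrix (Fin d) (Fin d) ℂ) (g : G) : IsIntegral ℤ (π (.single g 1)).trace := by
  rw [Matrix.trace_eq_sum_roots_charpoly]
  refine IsIntegral.multiset_sum fun x hx => IsIntegral.of_pow (Fintype.card_pos (α := G)) ?_
  rw [pow_eq_one_of_mem_roots_charpoly (pow_card_map_single π g) hx]
  exact isIntegral_one

theorem exists_map_eq_algebraMap_of_commute (hπ : Function.Surjective π) {z : MonoidAlgebra ℂ G}
    (hz : ∀ h : G, MonoidAlgebra.single h 1 * z = z * MonoidAlgebra.single h 1) :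
    ∃ w, π z = algebraMap ℂ _ w := by
  refine (Algebra.IsCentral.mem_center_iff ℂ).1 (Subalgebra.mem_center_iff.2 fun b => ?_)
  obtain ⟨b, rfl⟩ := hπ b
  rw [← map_mul, ← map_mul]
  congr 1
  induction b using MonoidAlgebra.induction_linear with
  | zero => simp
  | add f g hf hg => rw [add_mul, mul_add, hf, hg]
  | single h r =>
    have : MonoidAlgebra.single h r = r • MonoidAlgebra.single h (1 : ℂ) := by
      rw [MonoidAlgebra.smul_single', mul_one]
    rw [this, smul_mul_assoc, mul_smul_comm, hz h]

theorem trace_eq_zero_or_scalar_of_coprime [Fintype G] (hπ : Function.Surjective π)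
    (hd : d ≠ 0) (g : G) (hcop : Nat.Coprime (Nat.card {x // IsConj g x}) d) :
    (π (.single g 1)).trace = 0 ∨ ∃ c, π (.single g 1) = algebraMap ℂ _ c := by
  classical
  set c := Nat.card {x // IsConj g x} with hc
  let z (R : Type) [Semiring R] : MonoidAlgebra R G :=
    ∑ x : {x // IsConj g x}, MonoidAlgebra.single x.1 1
  have hzcomm (h : G) : MonoidAlgebra.single h 1 * z ℂ = z ℂ * MonoidAlgebra.single h 1 := by
    simp only [z, Finset.mul_sum, Finset.sum_mul, MonoidAlgebra.single_mul_single, mul_one]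
    refine Fintype.sum_equiv ((MulAut.conj h).toEquiv.subtypeEquiv fun x => ?_) _ _ fun x => ?_
    · exact ⟨fun hx => hx.trans (isConj_iff.2 ⟨h, rfl⟩),
        fun hx => hx.trans (isConj_iff.2 ⟨h, rfl⟩).symm⟩
    · have : h * x.1 = h * x.1 * h⁻¹ * h := by group
      exact congrArg (MonoidAlgebra.single · (1 : ℂ)) this
  obtain ⟨w, hw⟩ := exists_map_eq_algebraMap_of_commute hπ hzcomm
  have : NeZero d := ⟨hd⟩
  have hwint : IsIntegral ℤ w := by
    have h1 : IsIntegral ℤ (z ℤ) := IsIntegral.of_finite ℤ _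
    have h2 : MonoidAlgebra.mapRingHom G (Int.castRingHom ℂ) (z ℤ) = z ℂ := by
      simp only [z, map_sum, MonoidAlgebra.mapRingHom_single, map_one]
    have h3 := h1.map ((π.toRingHom.comp
      (MonoidAlgebra.mapRingHom G (Int.castRingHom ℂ))).toIntAlgHom)
    have h4 : IsIntegral ℤ (algebraMap ℂ (Matrix (Fin d) (Fin d) ℂ) w) := by
      rw [← hw, ← h2]; exact h3
    exact (isIntegral_algHom_iff (Algebra.ofId ℂ (Matrix (Fin d) (Fin d) ℂ) |>.restrictScalars ℤ)
      (algebraMap ℂ _).injective).1 h4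
  set M := π (.single g 1) with hM
  have hMn : M ^ Fintype.card G = 1 := pow_card_map_single π g
  have hn : Fintype.card G ≠ 0 := Fintype.card_ne_zero
  have hroots : ∀ x ∈ M.charpoly.roots, x ^ Fintype.card G = 1 := fun x hx =>
    pow_eq_one_of_mem_roots_charpoly hMn hx
  have htr : (c : ℂ) * M.trace = d * w := by
    have h1 := congrArg Matrix.trace hw
    have h2 (x : {x // IsConj g x}) : (π (.single x.1 1)).trace = M.trace := by
      obtain ⟨y, hy⟩ := isConj_iff.1 x.2
      rw [← hy, show MonoidAlgebra.single (y * g * y⁻¹) (1 : ℂ) =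
        .single y 1 * .single g 1 * .single y⁻¹ 1 by simp [MonoidAlgebra.single_mul_single],
        map_mul, Matrix.trace_mul_comm, ← map_mul, ← mul_assoc]
      simp [MonoidAlgebra.single_mul_single, hM]
    simp only [z, map_sum, Matrix.trace_sum, h2, Finset.sum_const, Finset.card_univ, nsmul_eq_mul,
      ← Nat.card_eq_fintype_card, ← hc] at h1
    simpa [Matrix.algebraMap_eq_diagonal, Matrix.trace_diagonal] using h1
  have htrint : IsIntegral ℤ M.trace := isIntegral_trace_map_single π g
  have hd' : (d : ℂ) ≠ 0 := by exact_mod_cast hd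
  have hint : IsIntegral ℤ (M.trace / d) := by
    have hb : (1 : ℤ) = c * c.gcdA d + d * c.gcdB d := by
      rw [← Nat.gcd_eq_gcd_ab]; rw [hcop.gcd_eq_one]; rfl
    have hb' : (1 : ℂ) = c * (c.gcdA d : ℤ) + d * (c.gcdB d : ℤ) := by exact_mod_cast hb
    have : M.trace / d = (c.gcdA d : ℤ) * w + (c.gcdB d : ℤ) * M.trace := by
      field_simp
      linear_combination M.trace * hb' + (c.gcdA d : ℤ) * htr
    rw [this]
    exact (isIntegral_algebraMap.mul hwint).add (isIntegral_algebraMap.mul htrint)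
  have hcardroots : (M.charpoly.roots.card : ℂ) = d := by
    rw [← (IsAlgClosed.splits M.charpoly).natDegree_eq_card_roots, Matrix.charpoly_natDegree_eq_dim,
      Fintype.card_fin]
  refine (eq_zero_or_forall_eq_of_isIntegral_average hn hroots (α := M.trace / d) ?_ hint).imp
    (fun h => ?_) fun h => ⟨_, eq_scalar_of_pow_eq_one hn hMn h⟩
  · rw [hcardroots, ← Matrix.trace_eq_sum_roots_charpoly]; field_simp
  · simpa [hd'] using h

theorem map_eq_algebraMap_of_forall_single_eq_one (h : ∀ g : G, π (.single g 1) = 1)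
    (x : MonoidAlgebra ℂ G) : π x = algebraMap ℂ _ (MonoidAlgebra.lift ℂ ℂ G 1 x) := by
  have : π = (Algebra.ofId ℂ _).comp (MonoidAlgebra.lift ℂ ℂ G 1) :=
    MonoidAlgebra.algHom_ext (fun g => (h g).trans (by simp)) (Subsingleton.elim _ _)
  exact congrArg (· x) this

theorem eq_one_of_forall_single_eq_one (hπ : Function.Surjective π) (hd : d ≠ 0)
    (h : ∀ g : G, π (.single g 1) = 1) : d = 1 := by
  have hs : Function.Surjective (Algebra.linearMap ℂ (Matrix (Fin d) (Fin d) ℂ)) := fun B => by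
    obtain ⟨x, rfl⟩ := hπ B
    exact ⟨_, (map_eq_algebraMap_of_forall_single_eq_one h x).symm⟩
  have := LinearMap.finrank_le_finrank_of_surjective hs
  simp only [Module.finrank_matrix, Module.finrank_self, Fintype.card_fin, mul_one] at this
  nlinarith [Nat.pos_of_ne_zero hd]

theorem exists_forall_single_eq_one [Fintype G] {n : ℕ} {d : Fin n → ℕ}
    (e : MonoidAlgebra ℂ G ≃ₐ[ℂ] Π i, Matrix (Fin (d i)) (Fin (d i)) ℂ) :
    ∃ i, ∀ h : G, e (.single h 1) i = 1 := by
  let z : MonoidAlgebra ℂ G := ∑ x : G, .single x 1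
  have hl (h : G) : MonoidAlgebra.single h 1 * z = z := by
    simp only [z, Finset.mul_sum, MonoidAlgebra.single_mul_single, mul_one]
    exact Fintype.sum_equiv (Equiv.mulLeft h) _ _ fun x => rfl
  have hr (h : G) : z * MonoidAlgebra.single h 1 = z := by
    simp only [z, Finset.sum_mul, MonoidAlgebra.single_mul_single, mul_one]
    exact Fintype.sum_equiv (Equiv.mulRight h) _ _ fun x => rfl
  have hz : z ≠ 0 := fun h => by
    have := congrArg (MonoidAlgebra.lift ℂ ℂ G 1) h
    simp [z] at this
  obtain ⟨i, hi⟩ : ∃ i, e z i ≠ 0 := by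
    by_contra! h
    exact hz (e.injective (by rw [map_zero]; exact funext h))
  refine ⟨i, fun h => ?_⟩
  obtain ⟨w, hw⟩ := exists_map_eq_algebraMap_of_commute
    (π := (Pi.evalAlgHom ℂ _ i).comp e.toAlgHom)
    ((Function.surjective_eval i).comp e.surjective) (z := z) fun h => by rw [hl, hr]
  replace hw : e z i = algebraMap ℂ _ w := hw
  have hw0 : w ≠ 0 := by rintro rfl; simp [hw] at hi
  have h1 : e (.single h 1) i * e z i = e z i := by rw [← Pi.mul_apply, ← map_mul, hl]
  rw [hw, ← Algebra.commutes, ← Algebra.smul_def, Algebra.algebraMap_eq_smul_one] at h1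
  exact smul_right_injective _ hw0 h1

theorem forall_single_eq_one_of_scalar [IsSimpleGroup G] (hG : Subgroup.center G = ⊥) {g : G}
    (hg : g ≠ 1) {c : ℂ} (hc : π (.single g 1) = algebraMap ℂ _ c) (h : G) :
    π (.single h 1) = 1 := by
  let ρ : G →* Matrix (Fin d) (Fin d) ℂ := (π : _ →* _).comp (MonoidAlgebra.of ℂ G)
  rcases ρ.normal_ker.eq_bot_or_eq_top with hk | hk
  · refine absurd ?_ hg
    rw [← Subgroup.mem_bot, ← hG, Subgroup.mem_center_iff]
    intro x
    refine (MonoidHom.ker_eq_bot_iff ρ).1 hk ?_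
    have : ρ g = algebraMap ℂ _ c := hc
    rw [map_mul, map_mul, this, Algebra.commutes]
  · exact (MonoidHom.mem_ker (f := ρ)).1 (hk ▸ Subgroup.mem_top h)

end

theorem not_isIntegral_of_one_add_prime_mul_eq_zero {p : ℕ} (hp : p.Prime) {y : ℂ}
    (hy : 1 + p * y = 0) : ¬ IsIntegral ℤ y := fun hint => by
  have hp0 : (p : ℂ) ≠ 0 := by exact_mod_cast hp.ne_zero
  have h1 : y = algebraMap ℚ ℂ (-1 / p) := by
    simp only [eq_ratCast]; push_cast; field_simp; linear_combination hy
  rw [h1, isIntegral_algebraMap_iff (algebraMap ℚ ℂ).injective] at hint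
  obtain ⟨m, hm⟩ := IsIntegrallyClosed.isIntegral_iff.1 hint
  have hp0' : (p : ℚ) ≠ 0 := by exact_mod_cast hp.ne_zero
  have h2 : (p : ℤ) * (-m) = 1 := by
    simp only [eq_intCast] at hm
    field_simp at hm
    have : (m : ℚ) * p = -1 := hm
    have : m * p = -1 := by exact_mod_cast this
    linarith
  have := Int.isUnit_iff.1 (IsUnit.of_mul_eq_one _ h2)
  have := hp.two_le
  omega

/-- A finite simple group with a conjugacy class of prime power size, other than that of the
identity, is abelian. -/
theorem IsSimpleGroup.center_eq_top_of_card_isConj_eq_prime_pow {G : Type*} [Group G] [Fintype G]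
    [IsSimpleGroup G] {p k : ℕ} (hp : p.Prime) {g : G} (hg : g ≠ 1)
    (hc : Nat.card {x // IsConj g x} = p ^ k) : Subgroup.center G = ⊤ := by
  have : (Subgroup.center G).Normal := inferInstance
  refine this.eq_bot_or_eq_top.resolve_left fun hG => ?_
  obtain ⟨n, d, hd, ⟨e⟩⟩ :=
    IsSemisimpleRing.exists_algEquiv_pi_matrix_of_isAlgClosed ℂ (MonoidAlgebra ℂ G)
  let π (i : Fin n) : MonoidAlgebra ℂ G →ₐ[ℂ] Matrix (Fin (d i)) (Fin (d i)) ℂ :=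
    (Pi.evalAlgHom ℂ _ i).comp e.toAlgHom
  have hπ (i) : Function.Surjective (π i) := (Function.surjective_eval i).comp e.surjective
  obtain ⟨i₀, hi₀⟩ : ∃ i, ∀ h : G, π i (.single h 1) = 1 := exists_forall_single_eq_one e
  have huniq (i) (hi : i ≠ i₀) : ¬ ∀ h : G, π i (.single h 1) = 1 := fun h => by
    have h1 := map_eq_algebraMap_of_forall_single_eq_one h (e.symm (Pi.single i 1))
    have h2 := map_eq_algebraMap_of_forall_single_eq_one hi₀ (e.symm (Pi.single i 1))
    have := hd i
    have := hd i₀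
    have h3 : π i (e.symm (Pi.single i 1)) = 1 := by simp [π]
    have h4 : π i₀ (e.symm (Pi.single i 1)) = 0 := by simp [π, hi.symm]
    rw [h3, ← map_one (algebraMap ℂ _)] at h1
    rw [h4, ← map_zero (algebraMap ℂ _)] at h2
    exact one_ne_zero (((algebraMap ℂ _).injective h1).trans ((algebraMap ℂ _).injective h2).symm)
  have hsum : ∑ i, d i * (π i (.single g 1)).trace = 0 := by
    rw [← trace_mulLeft_single hg, ← LinearMap.trace_conj' _ e.toLinearEquiv]
    refine (trace_mulLeft_pi_matrix d (e (.single g 1))).symm.trans ?_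
    congr 1
    refine LinearMap.ext fun x => ?_
    simp [LinearEquiv.conj_apply]
  have hterm (i) (hi : i ≠ i₀) :
      ∃ y, IsIntegral ℤ y ∧ d i * (π i (.single g 1)).trace = p * y := by
    by_cases hpd : p ∣ d i
    · obtain ⟨m, hm⟩ := hpd
      refine ⟨m * (π i (.single g 1)).trace,
        (isIntegral_algebraMap (x := (m : ℤ))).mul (isIntegral_trace_map_single _ _), ?_⟩
      rw [show (d i : ℂ) = p * m by exact_mod_cast hm]; ring
    · refine ⟨0, isIntegral_zero, ?_⟩
      rcases trace_eq_zero_or_scalar_of_coprime (hπ i) (hd i).ne g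
        (hc ▸ ((Nat.Prime.coprime_iff_not_dvd hp).2 hpd).pow_left k) with h | ⟨c, h⟩
      · simp [h]
      · exact absurd (forall_single_eq_one_of_scalar hG hg h) (huniq i hi)
  choose! y hy hy' using hterm
  refine not_isIntegral_of_one_add_prime_mul_eq_zero hp (y := ∑ i ∈ Finset.univ.erase i₀, y i) ?_
    (IsIntegral.sum _ fun i hi => hy i (Finset.ne_of_mem_erase hi))
  rw [← hsum, ← Finset.add_sum_erase _ _ (Finset.mem_univ i₀), Finset.mul_sum, hi₀,
    eq_one_of_forall_single_eq_one (hπ i₀) (hd i₀).ne hi₀]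
  congr 1
  · simp
  · exact Finset.sum_congr rfl fun i hi => (hy' i (Finset.ne_of_mem_erase hi)).symm

theorem card_isConj_mul_card_centralizer {G : Type*} [Group G] [Fintype G] (g : G) :
    Nat.card {x // IsConj g x} * Nat.card (Subgroup.centralizer {g}) = Nat.card G := by
  classical
  rw [Subgroup.nat_card_centralizer_nat_card_stabilizer]
  have := MulAction.card_orbit_mul_card_stabilizer_eq_card_group (ConjAct G) g
  simp only [← Nat.card_eq_fintype_card] at this
  rw [show Nat.card G = Nat.card (ConjAct G) from rfl, ← this]
  congr 1
  refine Nat.card_congr (Equiv.subtypeEquivRight fun x => ?_)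
  rw [ConjAct.mem_orbit_conjAct, isConj_comm]

theorem isSolvable_of_card_eq_prime_pow {G : Type*} [Group G] [Finite G] {p n : ℕ}
    (hp : p.Prime) (h : Nat.card G = p ^ n) : Group.IsSolvable G := by
  have := Fact.mk hp
  have := (IsPGroup.of_card h).isNilpotent
  infer_instance

theorem IsSimpleGroup.isSolvable_of_card_eq {G : Type*} [Group G] [Fintype G] [IsSimpleGroup G]
    {p q a b : ℕ} (hp : p.Prime) (hq : q.Prime) (hcard : Nat.card G = p ^ a * q ^ b) :
    Group.IsSolvable G := by
  rcases eq_or_ne p q with rfl | hpq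
  · exact isSolvable_of_card_eq_prime_pow hp (by rw [hcard, pow_add])
  rcases eq_or_ne b 0 with rfl | hb
  · exact isSolvable_of_card_eq_prime_pow hp (by rw [hcard, pow_zero, mul_one])
  have := Fact.mk hq
  obtain ⟨Q⟩ : Nonempty (Sylow q G) := inferInstance
  have hQ : Nat.card Q = q ^ b := by
    rw [Q.card_eq_multiplicity, hcard]
    congr 1
    rw [Nat.factorization_mul (pow_ne_zero _ hp.ne_zero) (pow_ne_zero _ hq.ne_zero)]
    simp [hp.factorization_pow, hq.factorization_pow, hpq]
  have : Nontrivial Q := by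
    rw [← Finite.one_lt_card_iff_nontrivial, hQ]
    exact Nat.one_lt_pow hb hq.one_lt
  have := Q.isPGroup'.center_nontrivial
  obtain ⟨z, hz⟩ := exists_ne (1 : Subgroup.center Q)
  have hz1 : (z : G) ≠ 1 := by simpa using hz
  have hle : (Q : Subgroup G) ≤ Subgroup.centralizer {(z : G)} := fun x hx => by
    rw [Subgroup.mem_centralizer_singleton_iff]
    exact congrArg Subtype.val (Subgroup.mem_center_iff.1 z.2 ⟨x, hx⟩)
  obtain ⟨m, hm⟩ := Subgroup.card_dvd_of_le hle
  have hdvd : Nat.card {x // IsConj (z : G) x} ∣ p ^ a := by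
    refine ⟨m, ?_⟩
    have h := card_isConj_mul_card_centralizer (z : G)
    rw [hm, hcard, hQ] at h
    refine Nat.eq_of_mul_eq_mul_right (pow_pos hq.pos b) ?_
    rw [← h]; ring
  obtain ⟨k, -, hk⟩ := (Nat.dvd_prime_pow hp).1 hdvd
  have htop := IsSimpleGroup.center_eq_top_of_card_isConj_eq_prime_pow hp hz1 hk
  exact Group.isSolvable_of_comm fun x y => (Subgroup.mem_center_iff.1 (htop ▸ Subgroup.mem_top y) x)

theorem exists_eq_prime_pow_mul_prime_pow_of_dvd {p q a b n : ℕ} (hp : p.Prime) (hq : q.Prime)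
    (h : n ∣ p ^ a * q ^ b) : ∃ a' b', n = p ^ a' * q ^ b' := by
  obtain ⟨x, y, hx, hy, rfl⟩ := exists_dvd_and_dvd_of_dvd_mul h
  obtain ⟨a', -, rfl⟩ := (Nat.dvd_prime_pow hp).1 hx
  obtain ⟨b', -, rfl⟩ := (Nat.dvd_prime_pow hq).1 hy
  exact ⟨a', b', rfl⟩

theorem isSolvable_of_card_eq_prime_pow_mul_prime_pow (G : Type*) [Group G] [Finite G]
    {p q a b : ℕ} (hp : p.Prime) (hq : q.Prime) (hcard : Nat.card G = p ^ a * q ^ b) :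
    Group.IsSolvable G := by
  induction hn : Nat.card G using Nat.strong_induction_on generalizing G a b with
  | _ n ih =>
  subst hn
  rcases subsingleton_or_nontrivial G with hG | hG
  · exact inferInstance
  by_cases hs : IsSimpleGroup G
  · have := Fintype.ofFinite G
    exact IsSimpleGroup.isSolvable_of_card_eq hp hq hcard
  obtain ⟨N, hN, hbot, htop⟩ : ∃ N : Subgroup G, N.Normal ∧ N ≠ ⊥ ∧ N ≠ ⊤ := by
    by_contra! h
    exact hs ⟨fun N hN => or_iff_not_imp_left.2 (h N hN)⟩
  have hmul := N.card_eq_card_quotient_mul_card_subgroup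
  have hN1 : 1 < Nat.card N := N.one_lt_card_iff_ne_bot.2 hbot
  have hQ1 : 1 < Nat.card (G ⧸ N) := N.one_lt_index_of_ne_top htop
  obtain ⟨a₁, b₁, h₁⟩ :=
    exists_eq_prime_pow_mul_prime_pow_of_dvd hp hq (hcard ▸ N.card_subgroup_dvd_card)
  obtain ⟨a₂, b₂, h₂⟩ :=
    exists_eq_prime_pow_mul_prime_pow_of_dvd hp hq (hcard ▸ N.card_quotient_dvd_card)
  have : Group.IsSolvable N := ih _ (by nlinarith) N h₁ rfl
  have : Group.IsSolvable (G ⧸ N) := ih _ (by nlinarith) (G ⧸ N) h₂ rfl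
  exact Group.isSolvable_of_ker_le_range N.subtype (QuotientGroup.mk' N) (by simp)



/-- Burnside's `p^a q^b` theorem: a finite group of order `p^a · q^b` (with `p`, `q` prime)
is solvable. -/
theorem burnside_paqb_solvable (G : Type*) [Group G] [Fintype G]
    (p q a b : ℕ) (hp : p.Prime) (hq : q.Prime)
    (hcard : Fintype.card G = p ^ a * q ^ b) :
    IsSolvable G := by
  exact isSolvable_of_card_eq_prime_pow_mul_prime_pow G hp hq
    (Nat.card_eq_fintype_card.trans hcard)
end
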